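/- With G(x) = g_n(k|x|) Y_n^m(x/|x|) where g_n satisfies the spherical Bessel recurrences, ∂_{x_2} G(x) = −(ik/2)[ g_{n-1}(kr)( a_{n-1}^{m+1} Y_{n-1}^{m+1} + b_{n-1}^{m-1} Y_{n-1}^{m-1} ) + g_{n+1}(kr)( c_{n+1}^{m+1} Y_{n+1}^{m+1} + d_{n+1}^{m-1} Y_{n+1}^{m-1} ) ]. -/

import Mathlib

open Real

/-- Legendre polynomial of degree `n` (Rodrigues formula). -/
noncomputable def legendreP (n : ℕ) (z : ℝ) : ℝ :=
  (1 / (2 ^ n * (Nat.factorial n : ℝ))) *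
    iteratedDeriv n (fun x : ℝ => (x ^ 2 - 1) ^ n) z

/-- Associated Legendre function for `0 ≤ m ≤ n` (Condon–Shortley convention). -/
noncomputable def assocLegendreNat (n m : ℕ) (z : ℝ) : ℝ :=
  (-1 : ℝ) ^ m * (1 - z ^ 2) ^ ((m : ℝ) / 2) * iteratedDeriv m (legendreP n) z

/-- Associated Legendre function with integer degree and order, extended to
negative orders by `P_n^{-m} = (-1)^m ((n-m)!/(n+m)!) P_n^m`, and taken to be
zero when the order exceeds the degree or the degree is negative. -/
noncomputable def assocLegendre (n m : ℤ) (z : ℝ) : ℝ :=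
  if 0 ≤ n ∧ |m| ≤ n then
    if 0 ≤ m then assocLegendreNat n.toNat m.toNat z
    else (-1 : ℝ) ^ (-m).toNat *
      ((Nat.factorial (n + m).toNat : ℝ) / (Nat.factorial (n - m).toNat : ℝ)) *
      assocLegendreNat n.toNat (-m).toNat z
  else 0

/-- Normalization constant `γ_n^m = sqrt((2n+1)(n-m)!/(4π(n+m)!))`. -/
noncomputable def sphGamma (n m : ℤ) : ℝ :=
  Real.sqrt ((2 * (n : ℝ) + 1) * (Nat.factorial (n - m).toNat : ℝ) /
    (4 * Real.pi * (Nat.factorial (n + m).toNat : ℝ)))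

/-- Orthonormal spherical harmonic `Y_n^m(θ,φ) = γ_n^m e^{imφ} P_n^m(cos θ)`. -/
noncomputable def sphHarm (n m : ℤ) (θ φ : ℝ) : ℂ :=
  (sphGamma n m : ℂ) * Complex.exp (Complex.I * (m : ℂ) * (φ : ℂ)) *
    ((assocLegendre n m (Real.cos θ) : ℝ) : ℂ)

/-- `G(x) = g_n(k|x|) Y_n^m(x/|x|)`, with the angular spherical coordinates of `x`
recovered as `θ = arccos(x₃/|x|)` and `φ = arg(x₁ + i x₂)`. -/
noncomputable def sphG (g : ℤ → ℝ → ℂ) (k : ℝ) (n m : ℤ)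
    (x : EuclideanSpace ℝ (Fin 3)) : ℂ :=
  g n (k * ‖x‖) *
    sphHarm n m (Real.arccos (x 2 / ‖x‖)) (Complex.arg ((x 0 : ℂ) + (x 1 : ℂ) * Complex.I))


open Polynomial in
theorem iterD_X_mul (k : ℕ) (p : ℝ[X]) :
    derivative^[k] (X * p) = X * derivative^[k] p + C (k : ℝ) * derivative^[k - 1] p := by
  induction k with
  | zero => simp
  | succ k ih =>
    rw [Function.iterate_succ_apply', ih, Function.iterate_succ_apply']
    rcases k with _ | k
    · simp; ring
    · simp only [Nat.add_sub_cancel, derivative_add, derivative_mul, derivative_X, derivative_C, ← Function.iterate_succ_apply' derivative]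
      push_cast
      simp only [C_add, C_1]
      ring

open Polynomial in
noncomputable def LP (n : ℕ) : ℝ[X] :=
  C (1 / (2 ^ n * (Nat.factorial n : ℝ))) * derivative^[n] ((X ^ 2 - 1) ^ n)

open Polynomial in
theorem iteratedDeriv_poly (p : ℝ[X]) (k : ℕ) :
    iteratedDeriv k (fun x : ℝ => p.eval x) = fun x => (derivative^[k] p).eval x := by
  induction k with
  | zero => simp
  | succ k ih =>
    rw [iteratedDeriv_succ, ih, Function.iterate_succ_apply']
    funext x
    exact Polynomial.deriv _

open Polynomial in
theorem legendreP_eq (n : ℕ) : legendreP n = fun z => (LP n).eval z := by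
  funext z
  have h : (fun x : ℝ => (x ^ 2 - 1) ^ n) = fun x => ((X ^ 2 - 1 : ℝ[X]) ^ n).eval x := by
    funext x; simp
  rw [legendreP, h, iteratedDeriv_poly]
  simp [LP]

open Polynomial in
theorem LP_natDegree (n : ℕ) : (LP n).natDegree ≤ n := by
  unfold LP
  refine (natDegree_C_mul_le _ _).trans ?_
  refine (natDegree_iterate_derivative _ _).trans ?_
  have : ((X ^ 2 - 1 : ℝ[X]) ^ n).natDegree ≤ n * 2 := by
    refine natDegree_pow_le_of_le n ?_
    compute_degree
  omega

open Polynomial in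
theorem LP_II (n : ℕ) : derivative (LP (n + 1)) = X * derivative (LP n) + C ((n : ℝ) + 1) * LP n := by
  have h1 : derivative ((X ^ 2 - 1 : ℝ[X]) ^ (n + 1)) = C (2 * ((n : ℝ) + 1)) * (X * (X ^ 2 - 1) ^ n) := by
    rw [derivative_pow]
    simp [show (C 2 : ℝ[X]) = 2 from rfl]
    ring
  have h2 : derivative^[n + 1] (derivative ((X ^ 2 - 1 : ℝ[X]) ^ (n + 1))) =
     C (2 * ((n : ℝ) + 1)) * (X * derivative^[n + 1] ((X ^ 2 - 1) ^ n) + C ((n : ℝ) + 1) * derivative^[n] ((X ^ 2 - 1) ^ n)) := by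
    rw [h1, iterate_derivative_C_mul, iterD_X_mul]
    simp
  have hc : (1 / (2 ^ n * (Nat.factorial n : ℝ))) = (1 / (2 ^ (n + 1) * (Nat.factorial (n + 1) : ℝ))) * (2 * ((n : ℝ) + 1)) := by
    rw [Nat.factorial_succ]; push_cast
    field_simp
    ring
  unfold LP
  rw [hc, derivative_C_mul, derivative_C_mul, ← Function.iterate_succ_apply' derivative, ← Function.iterate_succ_apply' derivative,
   Function.iterate_succ_apply, h2, C_mul]
  simp only [Nat.succ_eq_add_one, C_mul]
  generalize derivative^[n + 1] ((X ^ 2 - 1 : ℝ[X]) ^ n) = A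
  generalize derivative^[n] ((X ^ 2 - 1 : ℝ[X]) ^ n) = B
  generalize (C (1 / (2 ^ (n + 1) * (Nat.factorial (n + 1) : ℝ))) : ℝ[X]) = c
  ring

open Polynomial in
theorem LP_III (n : ℕ) : derivative (LP (n + 2)) = C (2 * (n : ℝ) + 3) * LP (n + 1) + derivative (LP n) := by
  have h1 : derivative (derivative ((X ^ 2 - 1 : ℝ[X]) ^ (n + 2))) =
     C (2 * ((n : ℝ) + 2) * (2 * n + 3)) * (X ^ 2 - 1) ^ (n + 1) + C (4 * ((n : ℝ) + 2) * (n + 1)) * (X ^ 2 - 1) ^ n := by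
    rw [derivative_pow]
    simp [derivative_pow, show (C 2 : ℝ[X]) = 2 from rfl, show (C 3 : ℝ[X]) = 3 from rfl, show (C 4 : ℝ[X]) = 4 from rfl]
    ring
  have h2 : derivative^[n + 1] (derivative (derivative ((X ^ 2 - 1 : ℝ[X]) ^ (n + 2)))) =
     C (2 * ((n : ℝ) + 2) * (2 * n + 3)) * derivative^[n + 1] ((X ^ 2 - 1) ^ (n + 1))
      + C (4 * ((n : ℝ) + 2) * (n + 1)) * derivative^[n + 1] ((X ^ 2 - 1) ^ n) := by
    rw [h1, iterate_map_add, iterate_derivative_C_mul, iterate_derivative_C_mul]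
  have hc : (1 / (2 ^ n * (Nat.factorial n : ℝ))) = (1 / (2 ^ (n + 2) * (Nat.factorial (n + 2) : ℝ))) * (4 * ((n : ℝ) + 2) * (n + 1)) := by
    rw [Nat.factorial_succ, Nat.factorial_succ]; push_cast
    field_simp
    norm_num
    ring
  have hc' : (2 * n + 3) * (1 / (2 ^ (n + 1) * (Nat.factorial (n + 1) : ℝ))) = (1 / (2 ^ (n + 2) * (Nat.factorial (n + 2) : ℝ))) * (2 * ((n : ℝ) + 2) * (2 * n + 3)) := by
    rw [Nat.factorial_succ (n + 1)]; push_cast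
    field_simp
    ring
  unfold LP
  rw [← mul_assoc, ← C_mul, hc', hc, derivative_C_mul, derivative_C_mul, ← Function.iterate_succ_apply' derivative, ← Function.iterate_succ_apply' derivative,
   Function.iterate_succ_apply, Function.iterate_succ_apply, h2, C_mul, C_mul]
  simp only [Nat.succ_eq_add_one, C_mul]
  generalize derivative^[n + 1] ((X ^ 2 - 1 : ℝ[X]) ^ n) = A
  generalize derivative^[n + 1] ((X ^ 2 - 1 : ℝ[X]) ^ (n + 1)) = B
  generalize (C (1 / (2 ^ (n + 2) * (Nat.factorial (n + 2) : ℝ))) : ℝ[X]) = c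
  ring

open Polynomial in
theorem LP_I (n : ℕ) : derivative (LP n) = X * derivative (LP (n + 1)) - C ((n : ℝ) + 1) * LP (n + 1) := by
  have h1 := LP_II (n + 1)
  have h2 := LP_III n
  rw [h2] at h1
  have : derivative (LP n) = X * derivative (LP (n + 1)) + (C (((n + 1 : ℕ) : ℝ) + 1) - C (2 * (n : ℝ) + 3)) * LP (n + 1) := by
    linear_combination h1
  rw [this, ← C_sub]
  have : (((n + 1 : ℕ) : ℝ) + 1) - (2 * (n : ℝ) + 3) = - ((n : ℝ) + 1) := by push_cast; ring
  rw [this, C_neg]; ring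

open Polynomial in
noncomputable def QP (n : ℤ) (M : ℕ) : ℝ[X] := if n < 0 then 0 else derivative^[M] (LP n.toNat)

noncomputable def qf (n : ℤ) (M : ℕ) (z : ℝ) : ℝ := (QP n M).eval z

theorem qf_zero (n : ℤ) (M : ℕ) (h : n < M) (z : ℝ) : qf n M z = 0 := by
  unfold qf QP
  split_ifs with h1
  · simp
  · rw [Polynomial.iterate_derivative_eq_zero]
    · simp
    · have := LP_natDegree n.toNat
      omega

theorem qf_deriv (n : ℤ) (M : ℕ) (z : ℝ) : HasDerivAt (qf n M) (qf n (M + 1) z) z := by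
  have h := (QP n M).hasDerivAt z
  have : qf n (M + 1) z = (QP n M).derivative.eval z := by
    unfold qf QP
    split_ifs
    · simp
    · rw [Function.iterate_succ_apply']
  rw [this]; exact h

open Polynomial in
theorem qf_C (n : ℤ) (hn : 0 ≤ n) (M : ℕ) (z : ℝ) :
    qf (n + 1) (M + 1) z = z * qf n (M + 1) z + (n + 1 + M) * qf n M z := by
  obtain ⟨n, rfl⟩ := Int.eq_ofNat_of_zero_le hn
  have h := congrArg (fun p => (derivative^[M] p).eval z) (LP_II n)
  simp only [iterate_map_add, iterate_derivative_C_mul, iterD_X_mul] at h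
  rw [← Function.iterate_succ_apply derivative, ← Function.iterate_succ_apply derivative] at h
  unfold qf QP
  have e1 : ((n : ℤ) + 1).toNat = n + 1 := by omega
  rw [if_neg (by omega), if_neg (by omega), if_neg (by omega), e1, Int.toNat_natCast, h]
  rcases M with _ | M
  · simp
  · rw [Nat.add_sub_cancel, ← Function.iterate_succ_apply derivative]
    simp only [eval_add, eval_sub, eval_mul, eval_X, eval_C, Nat.succ_eq_add_one]
    push_cast
    ring

open Polynomial in
theorem qf_A (n : ℤ) (hn : 0 ≤ n) (M : ℕ) (z : ℝ) :
    qf (n - 1) (M + 1) z = z * qf n (M + 1) z - (n - M) * qf n M z := by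
  obtain ⟨n, rfl⟩ := Int.eq_ofNat_of_zero_le hn
  rcases n with _ | n
  · rw [qf_zero _ _ (by simp), qf_zero _ (M+1) (by simp)]
    rcases M with _ | M
    · simp
    · rw [qf_zero _ (M+1) (by simp)]; simp
  have h := congrArg (fun p => (derivative^[M] p).eval z) (LP_I n)
  simp only [iterate_derivative_sub, iterate_derivative_C_mul, iterD_X_mul] at h
  rw [← Function.iterate_succ_apply derivative, ← Function.iterate_succ_apply derivative] at h
  unfold qf QP
  have e1 : (((n + 1 : ℕ) : ℤ) - 1).toNat = n := by omega
  rw [if_neg (by omega), if_neg (by omega), if_neg (by omega), e1, Int.toNat_natCast, h]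
  rcases M with _ | M
  · simp
  · rw [Nat.add_sub_cancel, ← Function.iterate_succ_apply derivative]
    simp only [eval_add, eval_sub, eval_mul, eval_X, eval_C, Nat.succ_eq_add_one]
    push_cast
    ring

theorem qf_ode (n : ℤ) (hn : 0 ≤ n) (M : ℕ) (z : ℝ) :
    (1 - z ^ 2) * qf n (M + 2) z = 2 * (M + 1) * z * qf n (M + 1) z - (n + M + 1) * (n - M) * qf n M z := by
  rcases hn.eq_or_lt with h | h
  · subst h
    rw [qf_zero _ (M + 2) (by omega), qf_zero _ (M + 1) (by omega)]
    rcases M with _ | M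
    · simp
    · rw [qf_zero _ (M+1) (by omega)]; simp
  have h1 := qf_C (n - 1) (by omega) (M + 1) z
  have h2 := qf_A n hn (M + 1) z
  have h3 := qf_A n hn M z
  rw [sub_add_cancel] at h1
  push_cast at *
  linear_combination h1 + z * h2 + (n + M + 1) * h3

theorem qf_B (n : ℤ) (hn : 0 ≤ n) (M : ℕ) (z : ℝ) :
    -(1 - z ^ 2) * qf (n - 1) (M + 2) z + 2 * (M + 1) * qf n (M + 1) z =
      (n + (M + 1)) * (n + M) * qf (n - 1) M z := by
  rcases hn.eq_or_lt with h | h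
  · subst h
    rw [qf_zero _ (M + 2) (by omega), qf_zero _ (M + 1) (by omega), qf_zero _ M (by omega)]
    simp
  have h1 := qf_C (n - 1) (by omega) M z
  have h2 := qf_ode (n - 1) (by omega) M z
  rw [sub_add_cancel] at h1
  push_cast at *
  linear_combination 2 * (M + 1) * h1 - h2

theorem qf_D (n : ℤ) (hn : 0 ≤ n) (M : ℕ) (z : ℝ) :
    -(1 - z ^ 2) * qf (n + 1) (M + 2) z + 2 * (M + 1) * qf n (M + 1) z =
      (n - M + 1) * (n - M) * qf (n + 1) M z := by
  have h1 := qf_A (n + 1) (by omega) M z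
  have h2 := qf_ode (n + 1) (by omega) M z
  rw [add_sub_cancel_right] at h1
  push_cast at *
  linear_combination 2 * (M + 1) * h1 - h2

theorem sqrt_aux (u p q c1 c2 : ℝ) (h1 : 0 ≤ c1) (h2 : 0 ≤ c2) (hp : 0 ≤ p) 
    (h : u * c1 ^ 2 = c2 ^ 2 * (p * q)) : √u * c1 = c2 * √p * √q := by
  have e1 : √u * c1 = √(u * c1 ^ 2) := by
    rw [Real.sqrt_mul' _ (sq_nonneg _), Real.sqrt_sq h1]
  rw [e1, h, Real.sqrt_mul (sq_nonneg _), Real.sqrt_sq h2, Real.sqrt_mul hp, mul_assoc]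

theorem gam_S1 (n : ℤ) (M : ℕ) (h : (M : ℤ) + 2 ≤ n) :
    sphGamma n M = (2 * (n : ℝ) + 1) * √(((n - M) * (n - M - 1)) / ((2 * (n : ℝ) + 1) * (2 * n - 1))) * sphGamma (n - 1) (M + 1) := by
  obtain ⟨d, rfl⟩ : ∃ d : ℕ, n = M + 2 + d := ⟨(n - M - 2).toNat, by omega⟩
  rw [← mul_one (sphGamma (M + 2 + d) M)]
  unfold sphGamma
  have hd : (0 : ℝ) < d + 1 := by positivity
  have hM : (0 : ℝ) ≤ M := by positivity
  rw [show ((M : ℤ) + 2 + d - M).toNat = d + 2 by omega, show ((M : ℤ) + 2 + d + M).toNat = 2 * M + d + 2 by omega,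
    show ((M : ℤ) + 2 + d - 1 - (M + 1)).toNat = d by omega, show ((M : ℤ) + 2 + d - 1 + (M + 1)).toNat = 2 * M + d + 2 by omega]
  have hf : ((d + 2).factorial : ℝ) = (d + 2) * (d + 1) * d.factorial := by
    rw [Nat.factorial_succ, Nat.factorial_succ]; push_cast; ring
  push_cast
  have p1 : (0 : ℝ) < 2 * (M + 2 + d) - 1 := by linarith
  refine sqrt_aux _ _ _ _ _ (by norm_num) (by positivity) ?_ ?_
  · apply div_nonneg <;> apply mul_nonneg <;> linarith
  · rw [hf]
    have p2 := p1.ne'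
    have p3 : (2 * ((M : ℝ) + 2 + d) + 1) ≠ 0 := by positivity
    field_simp
    ring

theorem gam_S2 (n : ℤ) (M : ℕ) (h : (M : ℤ) + 1 ≤ n) :
    sphGamma n (M + 1) * ((n + (M + 1)) * (n + M)) = (2 * (n : ℝ) + 1) * √(((n + (M + 1)) * (n + M)) / ((2 * (n : ℝ) + 1) * (2 * n - 1))) * sphGamma (n - 1) M := by
  obtain ⟨d, rfl⟩ : ∃ d : ℕ, n = M + 1 + d := ⟨(n - M - 1).toNat, by omega⟩
  unfold sphGamma
  have hd : (0 : ℝ) ≤ d := by positivity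
  have hM : (0 : ℝ) ≤ M := by positivity
  rw [show ((M : ℤ) + 1 + d - (M + 1)).toNat = d by omega, show ((M : ℤ) + 1 + d + (M + 1)).toNat = 2 * M + d + 2 by omega,
    show ((M : ℤ) + 1 + d - 1 - M).toNat = d by omega, show ((M : ℤ) + 1 + d - 1 + M).toNat = 2 * M + d by omega]
  have hf : ((2 * M + d + 2).factorial : ℝ) = (2 * M + d + 2) * (2 * M + d + 1) * (2 * M + d).factorial := by
    rw [Nat.factorial_succ, Nat.factorial_succ]; push_cast; ring
  push_cast
  have p1 : (0 : ℝ) < 2 * (M + 1 + d) - 1 := by linarith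
  refine sqrt_aux _ _ _ _ _ (by positivity) (by positivity) (by positivity) ?_
  · rw [hf]
    have p2 := p1.ne'
    have p3 : (2 * ((M : ℝ) + 1 + d) + 1) ≠ 0 := by positivity
    field_simp
    ring

theorem gam_S3 (n : ℤ) (M : ℕ) (h : (M : ℤ) ≤ n) :
    sphGamma n M = (2 * (n : ℝ) + 1) * √(((n + M + 2) * (n + M + 1)) / ((2 * (n : ℝ) + 1) * (2 * n + 3))) * sphGamma (n + 1) (M + 1) := by
  obtain ⟨d, rfl⟩ : ∃ d : ℕ, n = M + d := ⟨(n - M).toNat, by omega⟩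
  rw [← mul_one (sphGamma (M + d) M)]
  unfold sphGamma
  have hd : (0 : ℝ) ≤ d := by positivity
  have hM : (0 : ℝ) ≤ M := by positivity
  rw [show ((M : ℤ) + d - M).toNat = d by omega, show ((M : ℤ) + d + M).toNat = 2 * M + d by omega,
    show ((M : ℤ) + d + 1 - (M + 1)).toNat = d by omega, show ((M : ℤ) + d + 1 + (M + 1)).toNat = 2 * M + d + 2 by omega]
  have hf : ((2 * M + d + 2).factorial : ℝ) = (2 * M + d + 2) * (2 * M + d + 1) * (2 * M + d).factorial := by
    rw [Nat.factorial_succ, Nat.factorial_succ]; push_cast; ring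
  push_cast
  refine sqrt_aux _ _ _ _ _ (by positivity) (by positivity) (by positivity) ?_
  · rw [hf]
    have p3 : (2 * ((M : ℝ) + d) + 1) ≠ 0 := by positivity
    field_simp
    ring

theorem gam_S4 (n : ℤ) (M : ℕ) (h : (M : ℤ) + 1 ≤ n) :
    sphGamma n (M + 1) * ((n - M + 1) * (n - M)) = (2 * (n : ℝ) + 1) * √(((n - M + 1) * (n - M)) / ((2 * (n : ℝ) + 1) * (2 * n + 3))) * sphGamma (n + 1) M := by
  obtain ⟨d, rfl⟩ : ∃ d : ℕ, n = M + 1 + d := ⟨(n - M - 1).toNat, by omega⟩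
  unfold sphGamma
  have hd : (0 : ℝ) ≤ d := by positivity
  have hM : (0 : ℝ) ≤ M := by positivity
  rw [show ((M : ℤ) + 1 + d - (M + 1)).toNat = d by omega, show ((M : ℤ) + 1 + d + (M + 1)).toNat = 2 * M + d + 2 by omega,
    show ((M : ℤ) + 1 + d + 1 - M).toNat = d + 2 by omega, show ((M : ℤ) + 1 + d + 1 + M).toNat = 2 * M + d + 2 by omega]
  have hf : ((d + 2).factorial : ℝ) = (d + 2) * (d + 1) * d.factorial := by
    rw [Nat.factorial_succ, Nat.factorial_succ]; push_cast; ring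
  push_cast
  rw [show ((M : ℝ) + 1 + d - M) = d + 1 by ring]
  refine sqrt_aux _ _ _ _ _ (by positivity) (by positivity) (by positivity) ?_
  · rw [hf]
    have p3 : (2 * ((M : ℝ) + 1 + d) + 1) ≠ 0 := by positivity
    field_simp
    ring

theorem gam_neg (n : ℤ) (M : ℕ) (h : (M : ℤ) ≤ n) :
    sphGamma n (-M) * ((Nat.factorial (n - M).toNat : ℝ) / (Nat.factorial (n + M).toNat : ℝ)) = sphGamma n M := by
  have h0 : (0 : ℝ) ≤ n := by exact_mod_cast (by omega : (0 : ℤ) ≤ n)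
  unfold sphGamma
  rw [sub_neg_eq_add, ← sub_eq_add_neg]
  rw [← one_mul (√((2 * (n : ℝ) + 1) * ((n - M).toNat.factorial : ℝ) / (4 * π * ((n + M).toNat.factorial : ℝ)))),
    ← one_mul (1 * _), ← mul_assoc, ← Real.sqrt_one, Real.sqrt_one]
  have := sqrt_aux ((2 * (n : ℝ) + 1) * ((n + M).toNat.factorial : ℝ) / (4 * π * ((n - M).toNat.factorial : ℝ))) 1
    ((2 * (n : ℝ) + 1) * ((n - M).toNat.factorial : ℝ) / (4 * π * ((n + M).toNat.factorial : ℝ)))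
    ((Nat.factorial (n - M).toNat : ℝ) / (Nat.factorial (n + M).toNat : ℝ)) 1 (by positivity) (by norm_num) (by norm_num)
    (by field_simp)
  rw [this, Real.sqrt_one]

theorem assocNat_eq (n : ℤ) (hn : 0 ≤ n) (M : ℕ) (θ : ℝ) (hθ : 0 ≤ Real.sin θ) :
    assocLegendreNat n.toNat M (Real.cos θ) = (-1) ^ M * Real.sin θ ^ M * qf n M (Real.cos θ) := by
  unfold assocLegendreNat qf QP
  rw [if_neg (by omega), legendreP_eq, iteratedDeriv_poly]
  have : (1 - Real.cos θ ^ 2) ^ ((M : ℝ) / 2) = Real.sin θ ^ M := by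
    rw [← Real.sin_sq, ← Real.rpow_natCast, ← Real.rpow_mul hθ, ← Real.rpow_natCast]
    congr 1
    push_cast; ring
  rw [this]

theorem sphHarm_pos (n : ℤ) (M : ℕ) (θ φ : ℝ) (hθ : 0 ≤ Real.sin θ) :
    sphHarm n M θ φ = (sphGamma n M : ℂ) * (-1) ^ M * (Real.sin θ * Complex.exp (Complex.I * φ)) ^ M * (qf n M (Real.cos θ) : ℂ) := by
  unfold sphHarm assocLegendre
  by_cases h : (M : ℤ) ≤ n
  · rw [if_pos ⟨by omega, by simpa using h⟩, if_pos (by omega), Int.toNat_natCast, assocNat_eq n (by omega) M θ hθ,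
      mul_pow, ← Complex.exp_nat_mul]
    push_cast
    rw [show Complex.I * (M : ℂ) * φ = M * (Complex.I * φ) by ring]
    ring
  · rw [if_neg (by simp; omega), qf_zero n M (by omega)]
    simp

theorem sphHarm_neg (n : ℤ) (M : ℕ) (θ φ : ℝ) (hθ : 0 ≤ Real.sin θ) :
    sphHarm n (-M) θ φ = (sphGamma n M : ℂ) * (Real.sin θ * Complex.exp (-(Complex.I * φ))) ^ M * (qf n M (Real.cos θ) : ℂ) := by
  rcases M with _ | M
  · have := sphHarm_pos n 0 θ φ hθ
    simpa using this
  by_cases h : ((M + 1 : ℕ) : ℤ) ≤ n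
  · rw [← gam_neg n (M + 1) h]
    unfold sphHarm assocLegendre
    rw [if_pos ⟨by omega, by rw [abs_neg, Nat.abs_cast]; exact h⟩, if_neg (by omega), neg_neg, Int.toNat_natCast, assocNat_eq n (by omega) _ θ hθ,
      mul_pow, ← Complex.exp_nat_mul, sub_neg_eq_add, ← sub_eq_add_neg]
    generalize M + 1 = N
    have e : ((-1 : ℂ) ^ N) * (-1) ^ N = 1 := by rw [← mul_pow]; simp
    push_cast
    rw [show Complex.I * -(N : ℂ) * φ = N * (-(Complex.I * φ)) by ring]
    linear_combination (sphGamma n (-N) : ℂ) * Complex.exp (N * (-(Complex.I * φ))) * ((Nat.factorial (n - N).toNat : ℂ) / (Nat.factorial (n + N).toNat : ℂ)) * (Complex.sin θ) ^ N * (qf n N (Real.cos θ) : ℂ) * e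
  · unfold sphHarm assocLegendre
    rw [if_neg (by rw [abs_neg, Nat.abs_cast]; omega), qf_zero n (M + 1) (by omega)]
    simp

noncomputable def FF (g : ℤ → ℝ → ℂ) (k : ℝ) (n : ℤ) (M : ℕ) (τ : ℂ) (y : EuclideanSpace ℝ (Fin 3)) : ℂ :=
  g n (k * ‖y‖) * ((((y 0 : ℂ) + (y 1 : ℂ) * τ) / (‖y‖ : ℂ)) ^ M * ((qf n M (y 2 / ‖y‖) : ℝ) : ℂ))

theorem norm3_sq (y : EuclideanSpace ℝ (Fin 3)) : ‖y‖ ^ 2 = y 0 ^ 2 + y 1 ^ 2 + y 2 ^ 2 := by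
  rw [EuclideanSpace.real_norm_sq_eq, Fin.sum_univ_three]

theorem arccos_facts (y : EuclideanSpace ℝ (Fin 3)) (hy : y ≠ 0) :
    Real.cos (Real.arccos (y 2 / ‖y‖)) = y 2 / ‖y‖ ∧
    Real.sin (Real.arccos (y 2 / ‖y‖)) = ‖((y 0 : ℂ) + (y 1 : ℂ) * Complex.I)‖ / ‖y‖ := by
  have hp : 0 < ‖y‖ := norm_pos_iff.mpr hy
  have h2 := norm3_sq y
  have habs : |y 2| ≤ ‖y‖ := by
    apply abs_le_of_sq_le_sq _ hp.le
    nlinarith [sq_nonneg (y 0), sq_nonneg (y 1)]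
  have h3 : |y 2 / ‖y‖| ≤ 1 := by
    rw [abs_div, abs_norm]; exact (div_le_one hp).mpr habs
  refine ⟨Real.cos_arccos (abs_le.mp h3).1 (abs_le.mp h3).2, ?_⟩
  rw [Real.sin_arccos, Complex.norm_add_mul_I]
  rw [show 1 - (y 2 / ‖y‖) ^ 2 = (y 0 ^ 2 + y 1 ^ 2) / ‖y‖ ^ 2 by field_simp; linarith]
  rw [Real.sqrt_div (by positivity), Real.sqrt_sq hp.le]

theorem sphG_pos (g : ℤ → ℝ → ℂ) (k : ℝ) (n : ℤ) (M : ℕ) (y : EuclideanSpace ℝ (Fin 3)) (hy : y ≠ 0) :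
    sphG g k n M y = (sphGamma n M : ℂ) * (-1) ^ M * FF g k n M Complex.I y := by
  obtain ⟨h1, h2⟩ := arccos_facts y hy
  unfold sphG FF
  rw [sphHarm_pos _ _ _ _ (by rw [h2]; positivity), h1, h2]
  have h3 := Complex.norm_mul_exp_arg_mul_I ((y 0 : ℂ) + (y 1 : ℂ) * Complex.I)
  rw [mul_comm Complex.I]
  rw [mul_comm _ Complex.I] at *
  push_cast
  rw [div_mul_eq_mul_div, mul_comm _ Complex.I, mul_comm Complex.I (Complex.arg _ : ℂ), h3]
  ring

theorem sphG_neg (g : ℤ → ℝ → ℂ) (k : ℝ) (n : ℤ) (M : ℕ) (y : EuclideanSpace ℝ (Fin 3)) (hy : y ≠ 0) :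
    sphG g k n (-M) y = (sphGamma n M : ℂ) * FF g k n M (-Complex.I) y := by
  obtain ⟨h1, h2⟩ := arccos_facts y hy
  unfold sphG FF
  rw [sphHarm_neg _ _ _ _ (by rw [h2]; positivity), h1, h2]
  have h3 := congrArg (starRingEnd ℂ) (Complex.norm_mul_exp_arg_mul_I ((y 0 : ℂ) + (y 1 : ℂ) * Complex.I))
  rw [map_mul, ← Complex.exp_conj] at h3
  simp only [map_mul, map_add, Complex.conj_ofReal, Complex.conj_I] at h3
  push_cast
  rw [show -(Complex.I * (Complex.arg ((y 0 : ℂ) + (y 1 : ℂ) * Complex.I) : ℂ)) =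
    (Complex.arg ((y 0 : ℂ) + (y 1 : ℂ) * Complex.I) : ℂ) * -Complex.I by ring, div_mul_eq_mul_div]
  rw [h3]
  ring

theorem FF_diff (g : ℤ → ℝ → ℂ) (k : ℝ) (hk : 0 < k) (n : ℤ) (hd : DifferentiableOn ℝ (g n) (Set.Ioi 0))
    (M : ℕ) (τ : ℂ) (x : EuclideanSpace ℝ (Fin 3)) (hx : x ≠ 0) : DifferentiableAt ℝ (FF g k n M τ) x := by
  have hp : 0 < ‖x‖ := norm_pos_iff.mpr hx
  have hN : DifferentiableAt ℝ (fun y : EuclideanSpace ℝ (Fin 3) => ‖y‖) x := differentiableAt_id.norm ℝ hx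
  have hc (i : Fin 3) : DifferentiableAt ℝ (fun y : EuclideanSpace ℝ (Fin 3) => y i) x := by fun_prop
  have hof (f : EuclideanSpace ℝ (Fin 3) → ℝ) (hf : DifferentiableAt ℝ f x) :
      DifferentiableAt ℝ (fun y => (f y : ℂ)) x := Complex.ofRealCLM.differentiableAt.comp x hf
  unfold FF
  refine DifferentiableAt.mul ?_ (DifferentiableAt.mul (DifferentiableAt.pow ?_ M) (hof _ ?_))
  · have : DifferentiableAt ℝ (g n) (k * ‖x‖) :=
      (hd _ (Set.mem_Ioi.mpr (mul_pos hk hp))).differentiableAt (Ioi_mem_nhds (mul_pos hk hp))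
    exact this.comp x (hN.const_mul k)
  · simp only [div_eq_mul_inv]
    refine DifferentiableAt.mul ((hof _ (hc 0)).add ((hof _ (hc 1)).mul_const τ)) ?_
    have := hof _ (hN.fun_inv hp.ne')
    simpa using this
  · have h1 : DifferentiableAt ℝ (qf n M) (x 2 / ‖x‖) := (qf_deriv n M _).differentiableAt
    have h2 : DifferentiableAt ℝ (fun y : EuclideanSpace ℝ (Fin 3) => y 2 / ‖y‖) x := by
      simp only [div_eq_mul_inv]
      exact (hc 2).mul (hN.fun_inv hp.ne')
    exact h1.comp x h2

theorem FF_fderiv (g : ℤ → ℝ → ℂ) (k : ℝ) (hk : 0 < k) (n : ℤ) (hd : DifferentiableOn ℝ (g n) (Set.Ioi 0))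
    (M : ℕ) (τ : ℂ) (x : EuclideanSpace ℝ (Fin 3)) (hx : x ≠ 0) :
    fderiv ℝ (FF g k n M τ) x (EuclideanSpace.single 1 1) =
      ((k * (x 1 / ‖x‖) : ℝ) : ℂ) * deriv (g n) (k * ‖x‖) * ((((x 0 : ℂ) + (x 1 : ℂ) * τ) / (‖x‖ : ℂ)) ^ M * ((qf n M (x 2 / ‖x‖) : ℝ) : ℂ))
      + g n (k * ‖x‖) * ((M * (((x 0 : ℂ) + (x 1 : ℂ) * τ) / (‖x‖ : ℂ)) ^ (M - 1) *
         ((τ * ‖x‖ - ((x 0 : ℂ) + (x 1 : ℂ) * τ) * ((x 1 / ‖x‖ : ℝ) : ℂ)) / (‖x‖ : ℂ) ^ 2)) * ((qf n M (x 2 / ‖x‖) : ℝ) : ℂ)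
         + (((x 0 : ℂ) + (x 1 : ℂ) * τ) / (‖x‖ : ℂ)) ^ M * ((qf n (M + 1) (x 2 / ‖x‖) * (-(x 2 * (x 1 / ‖x‖)) / ‖x‖ ^ 2) : ℝ) : ℂ)) := by
  have hp : 0 < ‖x‖ := norm_pos_iff.mpr hx
  have hpc : (‖x‖ : ℂ) ≠ 0 := by exact_mod_cast hp.ne'
  set e : EuclideanSpace ℝ (Fin 3) := EuclideanSpace.single 1 1 with he
  set c : ℝ → EuclideanSpace ℝ (Fin 3) := fun t => x + t • e with hc
  have hc0 : c 0 = x := by simp [hc]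
  have hcd : HasDerivAt c e 0 := by
    have := ((hasDerivAt_id (0 : ℝ)).smul_const e).const_add x
    rw [one_smul] at this
    exact this
  have hF := (FF_diff g k hk n hd M τ x hx).hasFDerivAt
  rw [← hc0] at hF
  have h1 := hF.comp_hasDerivAt (0 : ℝ) hcd
  rw [hc0] at h1
  have a0 : ∀ t, c t 0 = x 0 := by intro t; simp [hc, he]
  have a1 : ∀ t, c t 1 = x 1 + t := by intro t; simp [hc, he]
  have a2 : ∀ t, c t 2 = x 2 := by intro t; simp [hc, he]
  have hN : HasDerivAt (fun t => ‖c t‖) (x 1 / ‖x‖) 0 := by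
    have e1 : (fun t => ‖c t‖) = fun t => √(x 0 ^ 2 + (x 1 + t) ^ 2 + x 2 ^ 2) := by
      funext t
      rw [← a0 t, ← a1 t, ← a2 t, ← norm3_sq, Real.sqrt_sq (norm_nonneg _)]
    have e2 : HasDerivAt (fun t : ℝ => x 0 ^ 2 + (x 1 + t) ^ 2 + x 2 ^ 2) (2 * x 1) 0 := by
      have := ((((hasDerivAt_id (0 : ℝ)).const_add (x 1)).pow 2).const_add (x 0 ^ 2)).add_const (x 2 ^ 2)
      simpa using this
    rw [e1]
    have e3 : x 0 ^ 2 + (x 1 + 0) ^ 2 + x 2 ^ 2 = ‖x‖ ^ 2 := by rw [norm3_sq]; ring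
    have := e2.sqrt (by rw [e3]; positivity)
    rw [e3, Real.sqrt_sq hp.le] at this
    convert this using 1
    field_simp
  have hg : HasDerivAt (fun t => g n (k * ‖c t‖)) (((k * (x 1 / ‖x‖) : ℝ) : ℂ) * deriv (g n) (k * ‖x‖)) 0 := by
    have hh : HasDerivAt (g n) (deriv (g n) (k * ‖x‖)) (k * ‖c 0‖) := by
      rw [hc0]
      exact ((hd _ (Set.mem_Ioi.mpr (mul_pos hk hp))).differentiableAt (Ioi_mem_nhds (mul_pos hk hp))).hasDerivAt
    have := hh.scomp (0 : ℝ) (hN.const_mul k)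
    rw [Complex.real_smul] at this
    exact this
  have hw : HasDerivAt (fun t => ((c t 0 : ℂ) + (c t 1 : ℂ) * τ)) τ 0 := by
    simp only [a0, a1]
    have := ((((hasDerivAt_id (0 : ℝ)).const_add (x 1)).ofReal_comp).mul_const τ).const_add (x 0 : ℂ)
    simpa using this
  have hW := (hw.div hN.ofReal_comp (by rw [hc0]; exact hpc)).pow M
  have hz : HasDerivAt (fun t => c t 2 / ‖c t‖) (-(x 2 * (x 1 / ‖x‖)) / ‖x‖ ^ 2) 0 := by
    simp only [a2]
    have := (hasDerivAt_const (0 : ℝ) (x 2)).div hN (by rw [hc0]; exact hp.ne')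
    rw [hc0] at this
    rw [zero_mul, zero_sub] at this
    exact this
  have hq : HasDerivAt (fun t => ((qf n M (c t 2 / ‖c t‖) : ℝ) : ℂ)) ((qf n (M + 1) (x 2 / ‖x‖) * (-(x 2 * (x 1 / ‖x‖)) / ‖x‖ ^ 2) : ℝ) : ℂ) 0 := by
    have hh : HasDerivAt (qf n M) (qf n (M + 1) (x 2 / ‖x‖)) (c 0 2 / ‖c 0‖) := by
      rw [hc0]; exact qf_deriv _ _ _
    exact (hh.comp (0 : ℝ) hz).ofReal_comp
  have h2 := hg.mul (hW.mul hq)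
  have h3 := h1.unique h2
  rw [h3]
  simp only [Pi.mul_apply, Pi.pow_apply, Pi.div_apply, hc0]

theorem FF_core (g : ℤ → ℝ → ℂ)
    (hdiff : ∀ ν : ℤ, DifferentiableOn ℝ (g ν) (Set.Ioi 0))
    (hg1 : ∀ ν : ℤ, 0 ≤ ν → ∀ r : ℝ, 0 < r →
      g ν r / (r : ℂ) = (g (ν - 1) r + g (ν + 1) r) / (2 * (ν : ℂ) + 1))
    (hg2 : ∀ ν : ℤ, 0 ≤ ν → ∀ r : ℝ, 0 < r →
      deriv (g ν) r = ((ν : ℂ) * g (ν - 1) r - ((ν : ℂ) + 1) * g (ν + 1) r) / (2 * (ν : ℂ) + 1))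
    (k : ℝ) (hk : 0 < k) (n : ℤ) (hn : 0 ≤ n)
    (r s z C S : ℝ) (hr : 0 < r) (x : EuclideanSpace ℝ (Fin 3)) (hx : ‖x‖ = r)
    (hx0 : x 0 = r * C * s) (hx1 : x 1 = r * S * s) (hx2 : x 2 = r * z) (hs : s ^ 2 = 1 - z ^ 2)
    (τ E Ei : ℂ) (hτ : τ ^ 2 = -1) (hE : E * Ei = 1) (hC : (C : ℂ) = (E + Ei) / 2)
    (hS : (S : ℂ) = -τ * (E - Ei) / 2) (M : ℕ) :
    ∃ D : ℂ, D * (2 * (n : ℂ) + 1) = 1 ∧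
    (∀ N : ℕ, M = N + 1 → fderiv ℝ (FF g k n M τ) x (EuclideanSpace.single 1 1) =
      -(τ * k / 2) * D *
        (g (n - 1) (k * r) * (-(s * E) ^ (N + 2) * qf (n - 1) (N + 2) z - (n + (N + 1)) * (n + N) * (s * E) ^ N * qf (n - 1) N z)
        + g (n + 1) (k * r) * (-(s * E) ^ (N + 2) * qf (n + 1) (N + 2) z - (n - N + 1) * (n - N) * (s * E) ^ N * qf (n + 1) N z))) ∧
    (M = 0 → fderiv ℝ (FF g k n M τ) x (EuclideanSpace.single 1 1) =
      -(τ * k / 2) * D *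
        (g (n - 1) (k * r) * (-(s * E) * qf (n - 1) 1 z + s * Ei * qf (n - 1) 1 z)
        + g (n + 1) (k * r) * (-(s * E) * qf (n + 1) 1 z + s * Ei * qf (n + 1) 1 z))) := by
  have hn2 : (2 * (n : ℂ) + 1) ≠ 0 := by
    have : (2 * n + 1 : ℤ) ≠ 0 := by omega
    exact_mod_cast this
  have hrc : (r : ℂ) ≠ 0 := by exact_mod_cast hr.ne'
  have hkc : (k : ℂ) ≠ 0 := by exact_mod_cast hk.ne'
  have hx' : x ≠ 0 := by rw [← norm_pos_iff, hx]; exact hr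
  refine ⟨(2 * (n : ℂ) + 1)⁻¹, inv_mul_cancel₀ hn2, ?_⟩
  generalize hD : (2 * (n : ℂ) + 1)⁻¹ = D
  have G1 := hg1 n hn (k * r) (mul_pos hk hr)
  have G2 := hg2 n hn (k * r) (mul_pos hk hr)
  rw [div_eq_mul_inv _ (2 * (n : ℂ) + 1), hD] at G1 G2
  rw [div_eq_iff (by push_cast; exact mul_ne_zero hkc hrc)] at G1
  have hw : (((x 0 : ℂ) + (x 1 : ℂ) * τ) / (r : ℂ)) = s * E := by
    rw [hx0, hx1]; push_cast
    rw [hC, hS]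
    field_simp
    linear_combination (-s * E + s * Ei) * hτ
  have hw' : ((x 0 : ℂ) + (x 1 : ℂ) * τ) = s * E * r := by
    rw [← hw]; field_simp
  have h1r : x 1 / r = S * s := by rw [hx1]; field_simp
  have h2r : x 2 / r = z := by rw [hx2]; field_simp
  have hzz : -(x 2 * (S * s)) / r ^ 2 = -(z * S * s) / r := by rw [hx2]; field_simp
  have hsc : (s : ℂ) ^ 2 = 1 - z ^ 2 := by exact_mod_cast congrArg (fun t : ℝ => (t : ℂ)) hs
  rw [FF_fderiv g k hk n (hdiff n) M τ x hx']
  rw [hx, hw, hw', h1r, h2r, hzz, G1, G2]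
  have hW : ((τ * r - s * E * r * ((S * s : ℝ) : ℂ)) / (r : ℂ) ^ 2) = (τ - s * E * (S * s)) / r := by
    push_cast; field_simp
  rw [hW]
  constructor
  · rintro N rfl
    have A1 := congrArg (fun t : ℝ => (t : ℂ)) (qf_A n hn (N + 1) z)
    have C1 := congrArg (fun t : ℝ => (t : ℂ)) (qf_C n hn (N + 1) z)
    have B1 := congrArg (fun t : ℝ => (t : ℂ)) (qf_B n hn N z)
    have D1 := congrArg (fun t : ℝ => (t : ℂ)) (qf_D n hn N z)
    push_cast at A1 C1 B1 D1 ⊢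
    rw [hS]
    generalize g (n - 1) (k * r) = gm
    generalize g (n + 1) (k * r) = gp
    have e1 : (N + 1 + 1) = N + 2 := rfl
    rw [e1] at *
    generalize (qf n (N + 1) z : ℂ) = q0 at *
    generalize (qf n (N + 2) z : ℂ) = q1 at *
    generalize (qf (n - 1) (N + 2) z : ℂ) = qa at *
    generalize (qf (n - 1) N z : ℂ) = qb at *
    generalize (qf (n + 1) (N + 2) z : ℂ) = qc at *
    generalize (qf (n + 1) N z : ℂ) = qd at *
    rw [← hsc] at B1 D1
    have key : (k : ℂ) * (-τ * (E - Ei) / 2 * s) * ((n * gm - (n + 1) * gp) * D) * ((s * E) ^ (N + 1) * q0) +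
       (gm + gp) * D * k * ((N + 1) * (s * E) ^ N * (τ - s * E * (-τ * (E - Ei) / 2 * s)) * q0 + (s * E) ^ (N + 1) * (q1 * (-(z * (-τ * (E - Ei) / 2) * s)))) 
       = -(τ * k / 2) * D * (gm * (-(s * E) ^ (N + 2) * qa - (n + (N + 1)) * (n + N) * (s * E) ^ N * qb) +
        gp * (-(s * E) ^ (N + 2) * qc - (n - N + 1) * (n - N) * (s * E) ^ N * qd)) := by
      linear_combination τ * D * k * (s * E) ^ N * (gm * (-((E - Ei) * E * s ^ 2 / 2) * A1 - qa * s ^ 2 / 2 * hE + 1 / 2 * B1)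
        + gp * (-((E - Ei) * E * s ^ 2 / 2) * C1 - qc * s ^ 2 / 2 * hE + 1 / 2 * D1))
    rw [← key]
    field_simp
  · rintro rfl
    have A1 := congrArg (fun t : ℝ => (t : ℂ)) (qf_A n hn 0 z)
    have C1 := congrArg (fun t : ℝ => (t : ℂ)) (qf_C n hn 0 z)
    push_cast at A1 C1 ⊢
    rw [hS]
    generalize g (n - 1) (k * r) = gm
    generalize g (n + 1) (k * r) = gp
    rw [A1, C1]
    field_simp
    ring

theorem fderiv_sphG_pos (g : ℤ → ℝ → ℂ) (k : ℝ) (hk : 0 < k) (n : ℤ) (hd : DifferentiableOn ℝ (g n) (Set.Ioi 0))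
    (M : ℕ) (x : EuclideanSpace ℝ (Fin 3)) (hx : x ≠ 0) (v : EuclideanSpace ℝ (Fin 3)) :
    fderiv ℝ (sphG g k n M) x v = (sphGamma n M : ℂ) * (-1) ^ M * fderiv ℝ (FF g k n M Complex.I) x v := by
  have h : sphG g k n M =ᶠ[nhds x] fun y => (sphGamma n M : ℂ) * (-1) ^ M * FF g k n M Complex.I y := by
    filter_upwards [isOpen_ne.mem_nhds hx] with y hy
    exact sphG_pos g k n M y hy
  rw [h.fderiv_eq, fderiv_const_mul (FF_diff g k hk n hd M _ x hx)]
  simp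

theorem fderiv_sphG_neg (g : ℤ → ℝ → ℂ) (k : ℝ) (hk : 0 < k) (n : ℤ) (hd : DifferentiableOn ℝ (g n) (Set.Ioi 0))
    (M : ℕ) (x : EuclideanSpace ℝ (Fin 3)) (hx : x ≠ 0) (v : EuclideanSpace ℝ (Fin 3)) :
    fderiv ℝ (sphG g k n (-M)) x v = (sphGamma n M : ℂ) * fderiv ℝ (FF g k n M (-Complex.I)) x v := by
  have h : sphG g k n (-M) =ᶠ[nhds x] fun y => (sphGamma n M : ℂ) * FF g k n M (-Complex.I) y := by
    filter_upwards [isOpen_ne.mem_nhds hx] with y hy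
    exact sphG_neg g k n M y hy
  rw [h.fderiv_eq, fderiv_const_mul (FF_diff g k hk n hd M _ x hx)]
  simp

theorem cast_P1 (n : ℤ) (hn : 0 ≤ n) (M : ℕ) (z : ℝ) (D : ℂ) (hD : D * (2 * (n : ℂ) + 1) = 1) (a : ℝ)
    (ha : a = ((n : ℝ) - M) * ((n : ℝ) - M - 1)) :
    (sphGamma n M : ℂ) * D * (qf (n - 1) (M + 1) z : ℂ) =
     ((√(a / ((2 * (n : ℝ) + 1) * (2 * (n : ℝ) - 1))) : ℝ) : ℂ) * sphGamma (n - 1) (M + 1) * (qf (n - 1) (M + 1) z : ℂ) := by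
  by_cases h : (M : ℤ) + 2 ≤ n
  · rw [gam_S1 n M h, ha]
    push_cast
    linear_combination (((√(((n : ℝ) - M) * ((n : ℝ) - M - 1) / ((2 * (n : ℝ) + 1) * (2 * (n : ℝ) - 1))) : ℝ) : ℂ) * sphGamma (n - 1) (M + 1) * (qf (n - 1) (M + 1) z : ℂ)) * hD
  · rw [qf_zero (n - 1) (M + 1) (by push_cast; omega)]; simp

theorem cast_P2 (n : ℤ) (M : ℕ) (h : (M : ℤ) + 1 ≤ n) (D : ℂ) (hD : D * (2 * (n : ℂ) + 1) = 1) (a : ℝ)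
    (ha : a = ((n : ℝ) + (M + 1)) * ((n : ℝ) + M)) :
    (sphGamma n (M + 1) : ℂ) * D * ((n + (M + 1)) * (n + M)) =
     ((√(a / ((2 * (n : ℝ) + 1) * (2 * (n : ℝ) - 1))) : ℝ) : ℂ) * sphGamma (n - 1) M := by
  have := congrArg (fun t : ℝ => (t : ℂ)) (gam_S2 n M h)
  rw [← ha] at this
  push_cast [ha] at this ⊢
  linear_combination D * this + (((√(((n : ℝ) + (M + 1)) * ((n : ℝ) + M) / ((2 * (n : ℝ) + 1) * (2 * (n : ℝ) - 1))) : ℝ) : ℂ) * sphGamma (n - 1) M) * hD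

theorem cast_P3 (n : ℤ) (M : ℕ) (h : (M : ℤ) ≤ n) (D : ℂ) (hD : D * (2 * (n : ℂ) + 1) = 1) (a : ℝ)
    (ha : a = ((n : ℝ) + M + 2) * ((n : ℝ) + M + 1)) :
    (sphGamma n M : ℂ) * D =
     ((√(a / ((2 * (n : ℝ) + 1) * (2 * (n : ℝ) + 3))) : ℝ) : ℂ) * sphGamma (n + 1) (M + 1) := by
  rw [gam_S3 n M h, ha]
  push_cast
  linear_combination (((√(((n : ℝ) + M + 2) * ((n : ℝ) + M + 1) / ((2 * (n : ℝ) + 1) * (2 * (n : ℝ) + 3))) : ℝ) : ℂ) * sphGamma (n + 1) (M + 1)) * hD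

theorem cast_P4 (n : ℤ) (M : ℕ) (h : (M : ℤ) + 1 ≤ n) (D : ℂ) (hD : D * (2 * (n : ℂ) + 1) = 1) (a : ℝ)
    (ha : a = ((n : ℝ) - M + 1) * ((n : ℝ) - M)) :
    (sphGamma n (M + 1) : ℂ) * D * ((n - M + 1) * (n - M)) =
     ((√(a / ((2 * (n : ℝ) + 1) * (2 * (n : ℝ) + 3))) : ℝ) : ℂ) * sphGamma (n + 1) M := by
  have := congrArg (fun t : ℝ => (t : ℂ)) (gam_S4 n M h)
  rw [← ha] at this
  push_cast [ha] at this ⊢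
  linear_combination D * this + (((√(((n : ℝ) - M + 1) * ((n : ℝ) - M) / ((2 * (n : ℝ) + 1) * (2 * (n : ℝ) + 3))) : ℝ) : ℂ) * sphGamma (n + 1) M) * hD

/-- `∂_{x₂} G(x) = −(ik/2)(g_{n-1}(kr)(a_{n-1}^{m+1} Y_{n-1}^{m+1} + b_{n-1}^{m-1} Y_{n-1}^{m-1})
+ g_{n+1}(kr)(c_{n+1}^{m+1} Y_{n+1}^{m+1} + d_{n+1}^{m-1} Y_{n+1}^{m-1}))`. -/
theorem sphG_deriv_x2
    (g : ℤ → ℝ → ℂ)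
    (hdiff : ∀ ν : ℤ, DifferentiableOn ℝ (g ν) (Set.Ioi 0))
    (hg1 : ∀ ν : ℤ, 0 ≤ ν → ∀ r : ℝ, 0 < r →
      g ν r / (r : ℂ) = (g (ν - 1) r + g (ν + 1) r) / (2 * (ν : ℂ) + 1))
    (hg2 : ∀ ν : ℤ, 0 ≤ ν → ∀ r : ℝ, 0 < r →
      deriv (g ν) r = ((ν : ℂ) * g (ν - 1) r - ((ν : ℂ) + 1) * g (ν + 1) r) / (2 * (ν : ℂ) + 1))
    (k : ℝ) (hk : 0 < k) (n m : ℤ) (hn : 0 ≤ n) (hm : |m| ≤ n)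
    (r θ φ : ℝ) (hr : 0 < r) (hθ : θ ∈ Set.Ioo (0 : ℝ) Real.pi)
    (x : EuclideanSpace ℝ (Fin 3))
    (hx0 : x 0 = r * Real.cos φ * Real.sin θ)
    (hx1 : x 1 = r * Real.sin φ * Real.sin θ)
    (hx2 : x 2 = r * Real.cos θ) :
    fderiv ℝ (sphG g k n m) x (EuclideanSpace.single 1 1) =
      -(Complex.I * (k : ℂ) / 2) *
        (g (n - 1) (k * r) *
            (((Real.sqrt ((((n : ℝ) - m) * ((n : ℝ) - m - 1)) /
                ((2 * (n : ℝ) + 1) * (2 * (n : ℝ) - 1))) : ℝ) : ℂ) *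
                sphHarm (n - 1) (m + 1) θ φ +
              ((Real.sqrt ((((n : ℝ) + m) * ((n : ℝ) + m - 1)) /
                ((2 * (n : ℝ) + 1) * (2 * (n : ℝ) - 1))) : ℝ) : ℂ) *
                sphHarm (n - 1) (m - 1) θ φ) +
          g (n + 1) (k * r) *
            (((Real.sqrt ((((n : ℝ) + m + 2) * ((n : ℝ) + m + 1)) /
                ((2 * (n : ℝ) + 1) * (2 * (n : ℝ) + 3))) : ℝ) : ℂ) *
                sphHarm (n + 1) (m + 1) θ φ +
              ((Real.sqrt ((((n : ℝ) - m + 2) * ((n : ℝ) - m + 1)) /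
                ((2 * (n : ℝ) + 1) * (2 * (n : ℝ) + 3))) : ℝ) : ℂ) *
                sphHarm (n + 1) (m - 1) θ φ)) := by
  have hs0 : 0 ≤ Real.sin θ := (Real.sin_pos_of_mem_Ioo hθ).le
  have hs : Real.sin θ ^ 2 = 1 - Real.cos θ ^ 2 := Real.sin_sq θ
  have hnx : ‖x‖ = r := by
    have h := norm3_sq x
    rw [hx0, hx1, hx2] at h
    have h' : ‖x‖ ^ 2 = r ^ 2 := by
      rw [h]
      linear_combination r ^ 2 * Real.sin θ ^ 2 * Real.sin_sq_add_cos_sq φ + r ^ 2 * hs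
    exact (sq_eq_sq₀ (norm_nonneg _) hr.le).mp h'
  have hx' : x ≠ 0 := by rw [← norm_pos_iff, hnx]; exact hr
  have hEE : Complex.exp (Complex.I * φ) * Complex.exp (-(Complex.I * φ)) = 1 := by
    rw [← Complex.exp_add]; simp
  have hC : ((Real.cos φ : ℝ) : ℂ) = (Complex.exp (Complex.I * φ) + Complex.exp (-(Complex.I * φ))) / 2 := by
    rw [Complex.ofReal_cos, Complex.cos, mul_comm Complex.I, neg_mul]
  have hS : ((Real.sin φ : ℝ) : ℂ) = -Complex.I * (Complex.exp (Complex.I * φ) - Complex.exp (-(Complex.I * φ))) / 2 := by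
    rw [Complex.ofReal_sin, Complex.sin, mul_comm Complex.I (φ : ℂ), neg_mul]
    ring
  have coreP := FF_core g hdiff hg1 hg2 k hk n hn r (Real.sin θ) (Real.cos θ) (Real.cos φ) (Real.sin φ) hr x hnx
    hx0 hx1 hx2 hs Complex.I _ _ Complex.I_sq hEE hC hS
  have coreN := FF_core g hdiff hg1 hg2 k hk n hn r (Real.sin θ) (Real.cos θ) (Real.cos φ) (Real.sin φ) hr x hnx
    hx0 hx1 hx2 hs (-Complex.I) _ _ (by rw [neg_sq, Complex.I_sq]) ((mul_comm _ _).trans hEE)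
    (hC.trans (by ring)) (hS.trans (by ring))
  have hcases : m = ((0 : ℕ) : ℤ) ∨ (∃ N : ℕ, m = ((N + 1 : ℕ) : ℤ)) ∨ (∃ N : ℕ, m = -((N + 1 : ℕ) : ℤ)) := by
    rcases lt_trichotomy m 0 with h | h | h
    · exact Or.inr (Or.inr ⟨(-m - 1).toNat, by omega⟩)
    · exact Or.inl (by omega)
    · exact Or.inr (Or.inl ⟨(m - 1).toNat, by omega⟩)
  rcases hcases with rfl | ⟨N, rfl⟩ | ⟨N, rfl⟩
  · obtain ⟨D, hD, -, h0⟩ := coreP 0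
    rw [fderiv_sphG_pos g k hk n (hdiff n) 0 x hx', h0 rfl]
    rw [show (((0 : ℕ) : ℤ) + 1) = ((1 : ℕ) : ℤ) by norm_num, show (((0 : ℕ) : ℤ) - 1) = -((1 : ℕ) : ℤ) by norm_num]
    rw [sphHarm_pos _ _ _ _ hs0, sphHarm_pos _ _ _ _ hs0, sphHarm_neg _ _ _ _ hs0, sphHarm_neg _ _ _ _ hs0]
    have p1 := cast_P1 n hn 0 (Real.cos θ) D hD (((n : ℝ) - ((0 : ℕ) : ℤ)) * ((n : ℝ) - ((0 : ℕ) : ℤ) - 1)) (by push_cast; ring)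
    have p2 := cast_P1 n hn 0 (Real.cos θ) D hD (((n : ℝ) + ((0 : ℕ) : ℤ)) * ((n : ℝ) + ((0 : ℕ) : ℤ) - 1)) (by push_cast; ring)
    have p3 := cast_P3 n 0 (by omega) D hD (((n : ℝ) + ((0 : ℕ) : ℤ) + 2) * ((n : ℝ) + ((0 : ℕ) : ℤ) + 1)) (by push_cast; ring)
    have p4 := cast_P3 n 0 (by omega) D hD (((n : ℝ) - ((0 : ℕ) : ℤ) + 2) * ((n : ℝ) - ((0 : ℕ) : ℤ) + 1)) (by push_cast; ring)
    rw [show (((0 : ℕ) : ℤ) + 1) = ((1 : ℕ) : ℤ) by norm_num] at p1 p2 p3 p4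
    rw [zero_add] at p1 p2
    generalize Complex.exp (Complex.I * φ) = E at *
    generalize Complex.exp (-(Complex.I * φ)) = Ei at *
    generalize ((√((((n : ℝ) - ((0 : ℕ) : ℤ)) * ((n : ℝ) - ((0 : ℕ) : ℤ) - 1)) / ((2 * (n : ℝ) + 1) * (2 * (n : ℝ) - 1))) : ℝ) : ℂ) = ca at *
    generalize ((√((((n : ℝ) + ((0 : ℕ) : ℤ)) * ((n : ℝ) + ((0 : ℕ) : ℤ) - 1)) / ((2 * (n : ℝ) + 1) * (2 * (n : ℝ) - 1))) : ℝ) : ℂ) = cb at *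
    generalize ((√((((n : ℝ) + ((0 : ℕ) : ℤ) + 2) * ((n : ℝ) + ((0 : ℕ) : ℤ) + 1)) / ((2 * (n : ℝ) + 1) * (2 * (n : ℝ) + 3))) : ℝ) : ℂ) = cc at *
    generalize ((√((((n : ℝ) - ((0 : ℕ) : ℤ) + 2) * ((n : ℝ) - ((0 : ℕ) : ℤ) + 1)) / ((2 * (n : ℝ) + 1) * (2 * (n : ℝ) + 3))) : ℝ) : ℂ) = cd at *
    linear_combination -(Complex.I * k / 2) * (g (n - 1) (k * r) * (Real.sin θ : ℂ) * (-E * p1 + Ei * p2)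
      + g (n + 1) (k * r) * (Real.sin θ : ℂ) * (qf (n + 1) 1 (Real.cos θ) : ℂ) * (-E * p3 + Ei * p4))
  · obtain ⟨D, hD, h1, -⟩ := coreP (N + 1)
    have hN : (N : ℤ) + 1 ≤ n := by rw [Nat.abs_cast] at hm; push_cast at hm; exact hm
    rw [fderiv_sphG_pos g k hk n (hdiff n) (N + 1) x hx', h1 N rfl]
    rw [show (((N + 1 : ℕ) : ℤ) + 1) = ((N + 2 : ℕ) : ℤ) by push_cast; ring, show (((N + 1 : ℕ) : ℤ) - 1) = ((N : ℕ) : ℤ) by push_cast; ring]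
    rw [sphHarm_pos _ _ _ _ hs0, sphHarm_pos _ _ _ _ hs0, sphHarm_pos _ _ _ _ hs0, sphHarm_pos _ _ _ _ hs0]
    have p1 := cast_P1 n hn (N + 1) (Real.cos θ) D hD (((n : ℝ) - ((N + 1 : ℕ) : ℤ)) * ((n : ℝ) - ((N + 1 : ℕ) : ℤ) - 1)) (by push_cast; ring)
    have p2 := cast_P2 n N hN D hD (((n : ℝ) + ((N + 1 : ℕ) : ℤ)) * ((n : ℝ) + ((N + 1 : ℕ) : ℤ) - 1)) (by push_cast; ring)
    have p3 := cast_P3 n (N + 1) (by push_cast; exact hN) D hD (((n : ℝ) + ((N + 1 : ℕ) : ℤ) + 2) * ((n : ℝ) + ((N + 1 : ℕ) : ℤ) + 1)) (by push_cast; ring)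
    have p4 := cast_P4 n N hN D hD (((n : ℝ) - ((N + 1 : ℕ) : ℤ) + 2) * ((n : ℝ) - ((N + 1 : ℕ) : ℤ) + 1)) (by push_cast; ring)
    rw [show (((N + 1 : ℕ) : ℤ) + 1) = ((N + 2 : ℕ) : ℤ) by push_cast; ring] at p1 p3
    rw [show ((N : ℤ) + 1) = ((N + 1 : ℕ) : ℤ) by push_cast; ring] at p2 p4
    rw [show N + 1 + 1 = N + 2 from rfl] at p1
    generalize Complex.exp (Complex.I * φ) = E at *
    generalize ((√((((n : ℝ) - ((N + 1 : ℕ) : ℤ)) * ((n : ℝ) - ((N + 1 : ℕ) : ℤ) - 1)) / ((2 * (n : ℝ) + 1) * (2 * (n : ℝ) - 1))) : ℝ) : ℂ) = ca at *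
    generalize ((√((((n : ℝ) + ((N + 1 : ℕ) : ℤ)) * ((n : ℝ) + ((N + 1 : ℕ) : ℤ) - 1)) / ((2 * (n : ℝ) + 1) * (2 * (n : ℝ) - 1))) : ℝ) : ℂ) = cb at *
    generalize ((√((((n : ℝ) + ((N + 1 : ℕ) : ℤ) + 2) * ((n : ℝ) + ((N + 1 : ℕ) : ℤ) + 1)) / ((2 * (n : ℝ) + 1) * (2 * (n : ℝ) + 3))) : ℝ) : ℂ) = cc at *
    generalize ((√((((n : ℝ) - ((N + 1 : ℕ) : ℤ) + 2) * ((n : ℝ) - ((N + 1 : ℕ) : ℤ) + 1)) / ((2 * (n : ℝ) + 1) * (2 * (n : ℝ) + 3))) : ℝ) : ℂ) = cd at *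
    linear_combination -(Complex.I * k / 2) * (-1) ^ N * ((Real.sin θ : ℂ) * E) ^ N * (g (n - 1) (k * r) * (((Real.sin θ : ℂ) * E) ^ 2 * p1 + (qf (n - 1) N (Real.cos θ) : ℂ) * p2)
      + g (n + 1) (k * r) * (((Real.sin θ : ℂ) * E) ^ 2 * (qf (n + 1) (N + 2) (Real.cos θ) : ℂ) * p3 + (qf (n + 1) N (Real.cos θ) : ℂ) * p4))
  · obtain ⟨D, hD, h1, -⟩ := coreN (N + 1)
    have hN : (N : ℤ) + 1 ≤ n := by rw [abs_neg, Nat.abs_cast] at hm; push_cast at hm; exact hm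
    rw [fderiv_sphG_neg g k hk n (hdiff n) (N + 1) x hx', h1 N rfl]
    rw [show (-((N + 1 : ℕ) : ℤ) + 1) = -((N : ℕ) : ℤ) by push_cast; ring, show (-((N + 1 : ℕ) : ℤ) - 1) = -((N + 2 : ℕ) : ℤ) by push_cast; ring]
    rw [sphHarm_neg _ _ _ _ hs0, sphHarm_neg _ _ _ _ hs0, sphHarm_neg _ _ _ _ hs0, sphHarm_neg _ _ _ _ hs0]
    have p1 := cast_P1 n hn (N + 1) (Real.cos θ) D hD (((n : ℝ) + (-((N + 1 : ℕ) : ℤ) : ℤ)) * ((n : ℝ) + (-((N + 1 : ℕ) : ℤ) : ℤ) - 1)) (by push_cast; ring)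
    have p2 := cast_P2 n N hN D hD (((n : ℝ) - (-((N + 1 : ℕ) : ℤ) : ℤ)) * ((n : ℝ) - (-((N + 1 : ℕ) : ℤ) : ℤ) - 1)) (by push_cast; ring)
    have p3 := cast_P3 n (N + 1) (by push_cast; exact hN) D hD (((n : ℝ) - (-((N + 1 : ℕ) : ℤ) : ℤ) + 2) * ((n : ℝ) - (-((N + 1 : ℕ) : ℤ) : ℤ) + 1)) (by push_cast; ring)
    have p4 := cast_P4 n N hN D hD (((n : ℝ) + (-((N + 1 : ℕ) : ℤ) : ℤ) + 2) * ((n : ℝ) + (-((N + 1 : ℕ) : ℤ) : ℤ) + 1)) (by push_cast; ring)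
    rw [show (((N + 1 : ℕ) : ℤ) + 1) = ((N + 2 : ℕ) : ℤ) by push_cast; ring] at p1 p3
    rw [show ((N : ℤ) + 1) = ((N + 1 : ℕ) : ℤ) by push_cast; ring] at p2 p4
    rw [show N + 1 + 1 = N + 2 from rfl] at p1
    generalize Complex.exp (-(Complex.I * φ)) = E at *
    generalize ((√((((n : ℝ) + (-((N + 1 : ℕ) : ℤ) : ℤ)) * ((n : ℝ) + (-((N + 1 : ℕ) : ℤ) : ℤ) - 1)) / ((2 * (n : ℝ) + 1) * (2 * (n : ℝ) - 1))) : ℝ) : ℂ) = ca at *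
    generalize ((√((((n : ℝ) - (-((N + 1 : ℕ) : ℤ) : ℤ)) * ((n : ℝ) - (-((N + 1 : ℕ) : ℤ) : ℤ) - 1)) / ((2 * (n : ℝ) + 1) * (2 * (n : ℝ) - 1))) : ℝ) : ℂ) = cb at *
    generalize ((√((((n : ℝ) - (-((N + 1 : ℕ) : ℤ) : ℤ) + 2) * ((n : ℝ) - (-((N + 1 : ℕ) : ℤ) : ℤ) + 1)) / ((2 * (n : ℝ) + 1) * (2 * (n : ℝ) + 3))) : ℝ) : ℂ) = cc at *
    generalize ((√((((n : ℝ) + (-((N + 1 : ℕ) : ℤ) : ℤ) + 2) * ((n : ℝ) + (-((N + 1 : ℕ) : ℤ) : ℤ) + 1)) / ((2 * (n : ℝ) + 1) * (2 * (n : ℝ) + 3))) : ℝ) : ℂ) = cd at *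
    linear_combination -(Complex.I * k / 2) * ((Real.sin θ : ℂ) * E) ^ N * (g (n - 1) (k * r) * (((Real.sin θ : ℂ) * E) ^ 2 * p1 + (qf (n - 1) N (Real.cos θ) : ℂ) * p2)
      + g (n + 1) (k * r) * (((Real.sin θ : ℂ) * E) ^ 2 * (qf (n + 1) (N + 2) (Real.cos θ) : ℂ) * p3 + (qf (n + 1) N (Real.cos θ) : ℂ) * p4))
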